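/- Let X be an n×p matrix, 2/n ≤ θ ≤ α/√n, s = 12θn + 1 ≤ 1/(8θ), and q > 0. Fix k ∈ {1,…,n} and indices 1 ≤ i < j ≤ p, set b = X e_i + X e_j and I = supp(X e_i) ∪ supp(X e_j), and suppose: (i) 1 ≤ |I| ≤ s; (ii) |b(k)| ≥ 2q and |b(l)| ≤ q for all l ≠ k; (iii) X has property P1: for every 1 ≤ i' < j' ≤ p, either |supp(X e_{i'}) ∪ supp(X e_{j'})| ∈ {0} ∪ (1/(8θ), n], or every minimizer z* of ‖zᵀX‖₁ subject to (X e_{i'} + X e_{j'})ᵀ z = 1 satisfies supp(z*) ⊆ supp(X e_{i'}) ∪ supp(X e_{j'}); and (iv) X has property P2 with γ = 1/2: for every J ⊆ {1,…,n} with |J| = s and every c ∈ ℝ^s whose second-largest absolute entry is at most (1/2) times its largest absolute entry, the minimizer of ‖zᵀX^J‖₁ subject to cᵀz = 1 is unique, 1-sparse, and supported on the index of the largest entry of c. Then every minimizer z* of ‖zᵀX‖₁ over {z ∈ ℝⁿ : bᵀz = 1} equals λ e_k for some λ ≠ 0. -/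

import Mathlib

open scoped BigOperators

noncomputable section

/-- The ℓ¹ norm of a vector. -/
def l1 {m : ℕ} (v : Fin m → ℝ) : ℝ := ∑ j, |v j|

/-- deterministic conclusion of the proof of Theorem 1.1: if `X` has
properties P1 and P2 (with `γ = 1/2`), `b = Xe_i + Xe_j` has its entry at `k` of absolute value
at least `2q` while all other entries are at most `q` in absolute value, and
`1 ≤ |I| ≤ s ≤ 1/(8θ)` where `I = supp(Xe_i) ∪ supp(Xe_j)`, then every minimizer of `‖zᵀX‖₁`
subject to `bᵀz = 1` is a nonzero multiple of `e_k`. -/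
theorem minimizer_is_multiple_of_basis_vector :
    ∃ α : ℝ, 0 < α ∧
    ∀ (n p : ℕ), 0 < n → 0 < p →
    ∀ (X : Matrix (Fin n) (Fin p) ℝ) (θ : ℝ) (s : ℕ) (q : ℝ),
      2 / (n : ℝ) ≤ θ → θ ≤ α / Real.sqrt n →
      (s : ℝ) = 12 * θ * n + 1 → (s : ℝ) ≤ 1 / (8 * θ) → 0 < q →
      ∀ (k : Fin n) (i j : Fin p), i < j →
      -- (i) 1 ≤ |I_{ij}| ≤ s
      1 ≤ (Finset.univ.filter (fun r : Fin n => X r i ≠ 0 ∨ X r j ≠ 0)).card →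
      (Finset.univ.filter (fun r : Fin n => X r i ≠ 0 ∨ X r j ≠ 0)).card ≤ s →
      -- (ii) |b(k)| ≥ 2q and |b(l)| ≤ q for l ≠ k
      2 * q ≤ |X k i + X k j| →
      (∀ l : Fin n, l ≠ k → |X l i + X l j| ≤ q) →
      -- (iii) property P1
      (∀ i' j' : Fin p, i' < j' →
        (Finset.univ.filter (fun r : Fin n => X r i' ≠ 0 ∨ X r j' ≠ 0)).card = 0 ∨
        (1 / (8 * θ) <
            ((Finset.univ.filter (fun r : Fin n => X r i' ≠ 0 ∨ X r j' ≠ 0)).card : ℝ) ∧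
          (Finset.univ.filter (fun r : Fin n => X r i' ≠ 0 ∨ X r j' ≠ 0)).card ≤ n) ∨
        ∀ z : Fin n → ℝ,
          ((∑ r, (X r i' + X r j') * z r = 1) ∧
            (∀ z' : Fin n → ℝ, (∑ r, (X r i' + X r j') * z' r = 1) →
              l1 (Matrix.vecMul z X) ≤ l1 (Matrix.vecMul z' X))) →
          ∀ r : Fin n, z r ≠ 0 → (X r i' ≠ 0 ∨ X r j' ≠ 0)) →
      -- (iv) property P2 with γ = 1/2
      (∀ J : Finset (Fin n), J.card = s →
        ∀ c : Fin n → ℝ, (∀ r ∉ J, c r = 0) → c ≠ 0 →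
        ∀ k' ∈ J, (∀ l ∈ J, l ≠ k' → |c l| ≤ (1 / 2) * |c k'|) →
        ∃ z : Fin n → ℝ,
          ((∀ r ∉ J, z r = 0) ∧ (∑ r, c r * z r = 1) ∧
            (∀ z' : Fin n → ℝ, ((∀ r ∉ J, z' r = 0) ∧ ∑ r, c r * z' r = 1) →
              l1 (Matrix.vecMul z X) ≤ l1 (Matrix.vecMul z' X))) ∧
          {r : Fin n | z r ≠ 0} = {k'} ∧
          (∀ z' : Fin n → ℝ,
            ((∀ r ∉ J, z' r = 0) ∧ (∑ r, c r * z' r = 1) ∧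
              (∀ z'' : Fin n → ℝ, ((∀ r ∉ J, z'' r = 0) ∧ ∑ r, c r * z'' r = 1) →
                l1 (Matrix.vecMul z' X) ≤ l1 (Matrix.vecMul z'' X))) →
            z' = z)) →
      -- conclusion
      ∀ z : Fin n → ℝ,
        ((∑ r, (X r i + X r j) * z r = 1) ∧
          (∀ z' : Fin n → ℝ, (∑ r, (X r i + X r j) * z' r = 1) →
            l1 (Matrix.vecMul z X) ≤ l1 (Matrix.vecMul z' X))) →
        ∃ lam : ℝ, lam ≠ 0 ∧ z = Pi.single k lam := by
  refine ⟨1, one_pos, ?_⟩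
  intro n p hn _ X θ s q hθ _ _ hsθ hq k i j hij hI1 hIs hk hl hP1 hP2 z hz
  set I := Finset.univ.filter (fun r : Fin n => X r i ≠ 0 ∨ X r j ≠ 0) with hI
  have hn' : (0 : ℝ) < n := by exact_mod_cast hn
  have hθ2 : 2 ≤ θ * n := (div_le_iff₀ hn').1 hθ
  have hθ0 : 0 < θ := lt_of_lt_of_le (by positivity) hθ
  have hsn : s ≤ n := by
    have h : 1 / (8 * θ) ≤ (n : ℝ) := by
      rw [div_le_iff₀ (by positivity)]
      linarith
    exact_mod_cast hsθ.trans h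
  have hIzero : ∀ r ∉ I, X r i + X r j = 0 := by
    intro r hr
    have h : X r i = 0 ∧ X r j = 0 := by simpa [hI] using hr
    rw [h.1, h.2, add_zero]
  have hbk : X k i + X k j ≠ 0 := abs_pos.1 (by linarith)
  have hkI : k ∈ I := not_imp_comm.1 (hIzero k) hbk
  have hzI : ∀ r ∉ I, z r = 0 := by
    rcases hP1 i j hij with h | h | h
    · exact absurd (show I.card = 0 from h) (by omega)
    · have hc : ((I.card : ℕ) : ℝ) ≤ s := by exact_mod_cast hIs
      exact absurd h.1 (not_lt.2 (hc.trans hsθ))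
    · intro r hr
      by_contra hzr
      exact hr (Finset.mem_filter.2 ⟨Finset.mem_univ r, h z hz r hzr⟩)
  obtain ⟨J, hIJ, hJ⟩ := Finset.exists_superset_card_eq hIs (by simpa using hsn)
  obtain ⟨w, -, hsupp, huniq⟩ := hP2 J hJ (fun r => X r i + X r j)
    (fun r hr => hIzero r fun h => hr (hIJ h)) (fun h => hbk (congrFun h k)) k (hIJ hkI)
    (fun l _ hlk => by have := hl l hlk; linarith)
  have hzw : z = w := huniq z
    ⟨fun r hr => hzI r fun h => hr (hIJ h), hz.1, fun z' hz' => hz.2 z' hz'.2⟩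
  rw [← hzw] at hsupp
  refine ⟨z k, hsupp.symm.subset rfl, ?_⟩
  ext r
  by_cases hr : r = k
  · rw [hr, Pi.single_eq_same]
  · rw [Pi.single_eq_of_ne hr]
    by_contra hzr
    exact hr (hsupp.subset hzr)
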